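/- arXiv:math/0609121 — 11 statements merged into one kernel-verified Lean document; each statement's English description precedes it below -/
import Mathlib

section
/- For every non-empty finite set D of positive integers with maximum element N, there exists a connected signed graph on exactly N + 1 vertices whose signed degree set is D. -/
/-- A signed graph on a vertex type `V`: a simple graph in which every edge is
assigned a sign, encoded as two edge-disjoint simple graphs, the graph of
positive edges and the graph of negative edges. -/
structure SignedGraph (V : Type*) where
  pos : SimpleGraph V
  neg : SimpleGraph V
  disjoint : ∀ u v : V, ¬(pos.Adj u v ∧ neg.Adj u v)

namespace SignedGraph

variable {V : Type*}

/-- The underlying simple graph of a signed graph. -/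
def underlying (G : SignedGraph V) : SimpleGraph V := G.pos ⊔ G.neg

/-- A signed graph is connected if its underlying simple graph is connected. -/
def Connected (G : SignedGraph V) : Prop := G.underlying.Connected

/-- The signed degree of a vertex: the number of positive edges incident with it
minus the number of negative edges incident with it. -/
noncomputable def sdeg (G : SignedGraph V) (v : V) : ℤ :=
  (Nat.card {u : V // G.pos.Adj v u} : ℤ) - (Nat.card {u : V // G.neg.Adj v u} : ℤ)

/-- The signed degree set of a signed graph: the set of distinct signed degrees
of its vertices. -/
def degreeSet (G : SignedGraph V) : Set ℤ := Set.range G.sdeg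

end SignedGraph

theorem aux (N : ℕ) : ∀ D : Finset ℕ, N ∈ D → (∀ d ∈ D, 0 < d ∧ d ≤ N) →
    ∃ G : SimpleGraph (Fin (N + 1)),
      Set.range (fun v => (G.neighborSet v).ncard) = (D : Set ℕ) := by
  induction N using Nat.strong_induction_on with
  | _ N ih =>
  intro D hN hD
  have compl_deg : ∀ (K : SimpleGraph (Fin (N + 1))) (v : Fin (N + 1)),
      (Kᶜ.neighborSet v).ncard = N - (K.neighborSet v).ncard := by
    intro K v
    classical
    have h := K.degree_compl v
    rw [← SimpleGraph.card_neighborSet_eq_degree, ← SimpleGraph.card_neighborSet_eq_degree,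
      Fintype.card_fin, ← Nat.card_eq_fintype_card, ← Nat.card_eq_fintype_card,
      Nat.add_sub_cancel] at h
    exact h
  by_cases hE : (D.erase N).Nonempty
  · set E := (D.erase N).image (fun d => N - d) with hEdef
    have hEn : E.Nonempty := hE.image _
    have hEb : ∀ e ∈ E, 0 < e ∧ e < N ∧ N - e ∈ D := by
      intro e he
      simp only [hEdef, Finset.mem_image, Finset.mem_erase] at he
      obtain ⟨d, ⟨h1, h2⟩, rfl⟩ := he
      have := hD d h2
      refine ⟨by omega, by omega, ?_⟩
      rwa [show N - (N - d) = d by omega]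
    set M := E.max' hEn with hM
    have hMN : M < N := (hEb M (E.max'_mem hEn)).2.1
    obtain ⟨H, hH⟩ := ih M hMN E (E.max'_mem hEn)
      (fun d hd => ⟨(hEb d hd).1, E.le_max' d hd⟩)
    let f : Fin (M + 1) ↪ Fin (N + 1) := Fin.castLEEmb (by omega)
    have d1 : ∀ v, ((H.map f).neighborSet (f v)).ncard = (H.neighborSet v).ncard := by
      intro v
      have : (H.map f).neighborSet (f v) = f '' (H.neighborSet v) := by
        ext u
        simp only [SimpleGraph.mem_neighborSet, SimpleGraph.map_adj, Set.mem_image]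
        constructor
        · rintro ⟨a, b, hab, ha, rfl⟩
          exact ⟨b, f.injective ha ▸ hab, rfl⟩
        · rintro ⟨b, hb, rfl⟩
          exact ⟨v, b, hb, rfl, rfl⟩
      rw [this, Set.ncard_image_of_injective _ f.injective]
    have d2 : ∀ v, v ∉ Set.range f → ((H.map f).neighborSet v).ncard = 0 := by
      intro v hv
      have : (H.map f).neighborSet v = ∅ := by
        ext u
        simp only [SimpleGraph.mem_neighborSet, SimpleGraph.map_adj, Set.mem_empty_iff_false,
          iff_false]
        rintro ⟨a, b, hab, rfl, rfl⟩
        exact hv ⟨a, rfl⟩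
      rw [this, Set.ncard_empty]
    refine ⟨(H.map f)ᶜ, ?_⟩
    ext x
    simp only [compl_deg, Set.mem_range, Finset.mem_coe]
    constructor
    · rintro ⟨v, rfl⟩
      by_cases hv : v ∈ Set.range f
      · obtain ⟨w, rfl⟩ := hv
        rw [d1]
        have : (H.neighborSet w).ncard ∈ (E : Set ℕ) := hH ▸ ⟨w, rfl⟩
        exact (hEb _ this).2.2
      · rw [d2 v hv]; exact hN
    · intro hx
      by_cases hxN : x = N
      · refine ⟨Fin.last N, ?_⟩
        rw [d2, hxN, Nat.sub_zero]
        rintro ⟨a, ha⟩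
        have := congrArg Fin.val ha
        simp [f] at this
        omega
      · have : N - x ∈ (E : Set ℕ) := by
          simp only [hEdef, Finset.mem_coe, Finset.mem_image, Finset.mem_erase]
          exact ⟨x, ⟨hxN, hx⟩, rfl⟩
        rw [← hH] at this
        obtain ⟨w, hw⟩ := this
        refine ⟨f w, ?_⟩
        have hw' : (H.neighborSet w).ncard = N - x := hw
        rw [d1, hw']
        have := hD x hx
        omega
  · refine ⟨(⊥ : SimpleGraph _)ᶜ, ?_⟩
    have h0 : ∀ v : Fin (N + 1), ((⊥ : SimpleGraph (Fin (N + 1))).neighborSet v).ncard = 0 := by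
      intro v
      have : (⊥ : SimpleGraph (Fin (N + 1))).neighborSet v = ∅ := by ext; simp
      rw [this, Set.ncard_empty]
    ext x
    simp only [compl_deg, h0, Set.mem_range, Finset.mem_coe, Nat.sub_zero]
    constructor
    · rintro ⟨_, rfl⟩; exact hN
    · intro hx
      refine ⟨0, ?_⟩
      by_contra hne
      exact hE ⟨x, by simp [hx, Ne.symm hne]⟩

theorem stmt_0 (D : Finset ℤ) (hne : D.Nonempty) (hpos : ∀ d ∈ D, 0 < d) :
    ∃ G : SignedGraph (Fin ((D.max' hne).toNat + 1)),
      G.Connected ∧ G.degreeSet = ↑D := by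
  have hm := D.max'_mem hne
  have hle : ∀ d ∈ D, d ≤ D.max' hne := fun d hd => D.le_max' d hd
  generalize D.max' hne = m at hm hle
  obtain ⟨G, hG⟩ := aux m.toNat (D.image Int.toNat) (Finset.mem_image_of_mem _ hm) (by
    intro d hd
    obtain ⟨e, he, rfl⟩ := Finset.mem_image.1 hd
    have := hpos e he
    have := hle e he
    omega)
  refine ⟨⟨G, ⊥, by simp⟩, ?_, ?_⟩
  · have : m.toNat ∈ ((D.image Int.toNat : Finset ℕ) : Set ℕ) := Finset.mem_image_of_mem _ hm
    rw [← hG] at this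
    obtain ⟨v, hv⟩ := this
    have hv' : (G.neighborSet v).ncard = m.toNat := hv
    have hsub : G.neighborSet v ⊆ {v}ᶜ := by
      intro u hu
      simpa using (G.ne_of_adj hu).symm
    have hcard : ({v}ᶜ : Set (Fin (m.toNat + 1))).ncard = m.toNat := by
      rw [Set.ncard_compl]; simp
    have heq := Set.eq_of_subset_of_ncard_le hsub (by rw [hcard, hv'])
    have hadj : ∀ u, u ≠ v → G.Adj v u := by
      intro u hu
      have : u ∈ G.neighborSet v := by rw [heq]; simpa using hu
      exact this
    show (G ⊔ ⊥).Connected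
    rw [sup_bot_eq, SimpleGraph.connected_iff_exists_forall_reachable]
    refine ⟨v, fun u => ?_⟩
    by_cases h : u = v
    · rw [h]
    · exact (hadj u h).reachable
  · have hs : ∀ v, SignedGraph.sdeg ⟨G, ⊥, by simp⟩ v = ((G.neighborSet v).ncard : ℤ) := by
      intro v
      simp only [SignedGraph.sdeg, SimpleGraph.bot_adj]
      simp [Set.ncard]
      rfl
    ext x
    simp only [SignedGraph.degreeSet, Set.mem_range, hs, Finset.mem_coe]
    constructor
    · rintro ⟨v, rfl⟩
      have : (G.neighborSet v).ncard ∈ ((D.image Int.toNat : Finset ℕ) : Set ℕ) := hG ▸ ⟨v, rfl⟩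
      obtain ⟨e, he, h⟩ := Finset.mem_image.1 (Finset.mem_coe.1 this)
      have := hpos e he
      rw [← h, Int.toNat_of_nonneg this.le]
      exact he
    · intro hx
      have : x.toNat ∈ ((D.image Int.toNat : Finset ℕ) : Set ℕ) := Finset.mem_image_of_mem _ hx
      rw [← hG] at this
      obtain ⟨v, hv⟩ := this
      have hv' : (G.neighborSet v).ncard = x.toNat := hv
      exact ⟨v, by rw [hv', Int.toNat_of_nonneg (hpos x hx).le]⟩
end

section
/- For every non-empty finite set D of positive integers with maximum element N, the minimum possible number of vertices of a connected signed graph whose signed degree set is D equals N + 1. -/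
theorem exists_graph_aux (d : ℕ → ℕ) (hd : StrictMono d) (h0 : 0 < d 0) (m : ℕ) :
    ∃ G : SignedGraph (Fin (d m + 1)), G.Connected ∧
      G.degreeSet = {x : ℤ | ∃ i ≤ m, x = (d i : ℤ)} := by
  classical
  obtain ⟨T, hT⟩ : ∃ T : ℕ → ℕ, T = fun i => d i + if m ≤ 2 * i then 1 else 0 := ⟨_, rfl⟩
  have hTm : StrictMono T := by
    refine strictMono_nat_of_lt_succ fun n => ?_
    have := hd (Nat.lt_succ_self n)
    simp only [hT, Nat.succ_eq_add_one] at *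
    split_ifs <;> omega
  have hTtop : T m = d m + 1 := by
    simp only [hT]
    rw [if_pos (by omega)]
  have hex : ∀ v : ℕ, ∃ i, v < T i := fun v =>
    ⟨v + 1, lt_of_lt_of_le (Nat.lt_succ_self v) (hTm.le_apply)⟩
  obtain ⟨s, hs⟩ : ∃ s : ℕ → ℕ, ∀ v i, s v ≤ i ↔ v < T i := by
    refine ⟨fun v => Nat.find (hex v), fun v i => ?_⟩
    rw [Nat.find_le_iff]
    constructor
    · rintro ⟨j, hj, h⟩
      exact lt_of_lt_of_le h (hTm.monotone hj)
    · intro h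
      exact ⟨i, le_rfl, h⟩
  have hsm : ∀ v : Fin (d m + 1), s v ≤ m := fun v => by
    rw [hs, hTtop]; exact v.2
  have hsurj : ∀ j ≤ m, ∃ v : Fin (d m + 1), s v = j := by
    intro j hj
    rcases j with _ | j
    · refine ⟨0, ?_⟩
      have : s 0 ≤ 0 := by
        rw [hs]; simp only [hT]; omega
      simpa using this
    · have hlt : T j < d m + 1 := by
        rw [← hTtop]; exact hTm (by omega)
      refine ⟨⟨T j, hlt⟩, ?_⟩
      have h1 : s (T j) ≤ j + 1 := by rw [hs]; exact hTm (by omega)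
      have h2 : ¬ s (T j) ≤ j := by rw [hs]; omega
      simp only; omega
  let P : SimpleGraph (Fin (d m + 1)) :=
    { Adj := fun u v => u ≠ v ∧ s u + s v ≤ m
      symm := ⟨fun u v h => ⟨h.1.symm, by have := h.2; omega⟩⟩
      loopless := ⟨fun u h => h.1 rfl⟩ }
  have hP : ∀ u v, P.Adj u v ↔ u ≠ v ∧ s u + s v ≤ m := fun u v => Iff.rfl
  let G : SignedGraph (Fin (d m + 1)) := ⟨P, ⊥, by simp⟩
  have hcount : ∀ i ≤ m,
      (Finset.univ.filter fun u : Fin (d m + 1) => (u : ℕ) < T i).card = T i := by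
    intro i hi
    rw [Fin.card_filter_val_lt]
    have := hTm.monotone hi
    omega
  have hdeg : ∀ v, G.sdeg v = (d (m - s v) : ℤ) := by
    intro v
    have hv := hsm v
    have e : (Finset.univ.filter fun u => P.Adj v u) =
        (Finset.univ.filter fun u : Fin (d m + 1) => (u : ℕ) < T (m - s v)).erase v := by
      ext u
      simp only [Finset.mem_filter, Finset.mem_univ, true_and, Finset.mem_erase, hP, ← hs]
      constructor
      · rintro ⟨h1, h2⟩; exact ⟨h1.symm, by omega⟩
      · rintro ⟨h1, h2⟩; exact ⟨h1.symm, by omega⟩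
    have hc : (Finset.univ.filter fun u => P.Adj v u).card = d (m - s v) := by
      rw [e, Finset.card_erase_eq_ite, hcount _ (by omega)]
      simp only [Finset.mem_filter, Finset.mem_univ, true_and, ← hs]
      simp only [hT]
      split_ifs <;> omega
    have hN : Nat.card {u // G.neg.Adj v u} = 0 := by
      simp [G]
    have hPc : Nat.card {u // G.pos.Adj v u} = d (m - s v) := by
      rw [← hc, Nat.card_eq_fintype_card, Fintype.card_subtype]
    unfold SignedGraph.sdeg
    rw [hN, hPc]; simp
  refine ⟨G, ?_, ?_⟩
  · obtain ⟨c, hc⟩ := hsurj 0 (Nat.zero_le _)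
    have hr : ∀ v, G.underlying.Reachable c v := by
      intro v
      by_cases h : c = v
      · rw [h]
      · apply SimpleGraph.Adj.reachable
        have h' := hsm v
        exact Or.inl ⟨h, by omega⟩
    have : Nonempty (Fin (d m + 1)) := ⟨c⟩
    exact SimpleGraph.Connected.mk fun u v => (hr u).symm.trans (hr v)
  · ext x
    simp only [SignedGraph.degreeSet, Set.mem_range, Set.mem_ofPred_eq, hdeg]
    constructor
    · rintro ⟨v, rfl⟩
      exact ⟨m - s v, by omega, rfl⟩
    · rintro ⟨i, hi, rfl⟩
      obtain ⟨v, hv⟩ := hsurj (m - i) (by omega)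
      exact ⟨v, by rw [hv, Nat.sub_sub_self hi]⟩

theorem exists_enum_aux (D : Finset ℤ) (hne : D.Nonempty) (hpos : ∀ d ∈ D, 0 < d) :
    ∃ (d : ℕ → ℕ) (m : ℕ), StrictMono d ∧ 0 < d 0 ∧ d m = (D.max' hne).toNat ∧
      {x : ℤ | ∃ i ≤ m, x = (d i : ℤ)} = ↑D := by
  classical
  have hk : 0 < D.card := Finset.card_pos.mpr hne
  let f := D.orderEmbOfFin rfl
  have hf : ∀ i, f i ∈ D := fun i => Finset.orderEmbOfFin_mem D rfl i
  let d : ℕ → ℕ := fun i => if h : i < D.card then (f ⟨i, h⟩).toNat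
    else (D.max' hne).toNat + 1 + i
  have hd1 : ∀ i (h : i < D.card), (d i : ℤ) = f ⟨i, h⟩ := by
    intro i h
    have := hpos _ (hf ⟨i, h⟩)
    simp only [d, dif_pos h]
    omega
  have hd2 : ∀ i, ¬ i < D.card → d i = (D.max' hne).toNat + 1 + i := by
    intro i h
    simp only [d, dif_neg h]
  refine ⟨d, D.card - 1, ?_, ?_, ?_, ?_⟩
  · refine strictMono_nat_of_lt_succ fun n => ?_
    by_cases h : n + 1 < D.card
    · have a := hd1 n (by omega)
      have b := hd1 (n + 1) h
      have c : f ⟨n, by omega⟩ < f ⟨n + 1, h⟩ := f.strictMono (by simp)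
      omega
    · have b := hd2 _ h
      by_cases h' : n < D.card
      · have a := hd1 n h'
        have c := D.le_max' _ (hf ⟨n, h'⟩)
        omega
      · have a := hd2 _ h'
        omega
  · have a := hd1 0 hk
    have := hpos _ (hf ⟨0, hk⟩)
    omega
  · have a := hd1 (D.card - 1) (by omega)
    have b : f ⟨D.card - 1, by omega⟩ = D.max' hne := Finset.orderEmbOfFin_last rfl hk
    omega
  · ext x
    simp only [Set.mem_ofPred_eq, Finset.mem_coe]
    constructor
    · rintro ⟨i, hi, rfl⟩
      rw [hd1 i (by omega)]
      exact hf _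
    · intro hx
      have : x ∈ Set.range f := by
        rw [Finset.range_orderEmbOfFin]; exact hx
      obtain ⟨i, rfl⟩ := this
      exact ⟨i, by omega, (hd1 i i.2).symm⟩

theorem stmt_2 (D : Finset ℤ) (hne : D.Nonempty) (hpos : ∀ d ∈ D, 0 < d) :
    IsLeast {n : ℕ | ∃ G : SignedGraph (Fin n), G.Connected ∧ G.degreeSet = ↑D}
      ((D.max' hne).toNat + 1) := by
  classical
  constructor
  · obtain ⟨d, m, h1, h2, h3, h4⟩ := exists_enum_aux D hne hpos
    have := exists_graph_aux d h1 h2 m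
    rw [h4, h3] at this
    exact this
  · rintro n ⟨G, -, hG⟩
    have hm : D.max' hne ∈ G.degreeSet := by
      rw [hG]; exact D.max'_mem hne
    obtain ⟨v, hv⟩ := hm
    have hlt : Nat.card {u // G.pos.Adj v u} < n := by
      rw [Nat.card_eq_fintype_card]
      have := Fintype.card_subtype_lt (p := fun u => G.pos.Adj v u) (x := v) (by simp)
      simpa using this
    unfold SignedGraph.sdeg at hv
    omega
end

section
/- For every non-empty finite set D of negative integers with minimum element M, there exists a connected signed graph on exactly |M| + 1 vertices whose signed degree set is D. -/
open Classical in
theorem kpw_aux (m : ℕ) : ∀ S : Finset ℕ, (∀ s ∈ S, 0 < s) → m ∈ S → (∀ s ∈ S, s ≤ m) →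
    ∃ G : SimpleGraph (Fin (m+1)), Set.range (fun v => G.degree v) = (S : Set ℕ) := by
  induction m using Nat.strong_induction_on with
  | _ m ih =>
    intro S hpos hm hmax
    by_cases hS : (S.erase m).Nonempty
    · have haS := Finset.min'_mem _ hS
      have hmin : ∀ x ∈ S.erase m, (S.erase m).min' hS ≤ x := fun x hx => Finset.min'_le _ x hx
      generalize (S.erase m).min' hS = a at haS hmin
      have ha := Finset.mem_erase.1 haS
      have ha0 := hpos a ha.2
      have ham := hmax a ha.2
      have hne := ha.1
      obtain ⟨H, hH⟩ := ih (m - a) (by omega) ((S.erase m).image (fun s => m - s))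
        (by
          intro s hs
          obtain ⟨x, hx, rfl⟩ := Finset.mem_image.1 hs
          have h1 := Finset.mem_erase.1 hx
          have h2 := hmax x h1.2
          have h3 := h1.1
          omega)
        (Finset.mem_image_of_mem _ haS)
        (by
          intro s hs
          obtain ⟨x, hx, rfl⟩ := Finset.mem_image.1 hs
          have h1 := hmin x hx
          omega)
      have hle : m - a + 1 ≤ m + 1 := by omega
      let e : Fin (m - a + 1) ↪ Fin (m + 1) := Fin.castLEEmb hle
      have hdeg1 : ∀ v, (H.map e).degree (e v) = H.degree v := by
        intro v
        rw [← SimpleGraph.card_neighborFinset_eq_degree, ← SimpleGraph.card_neighborFinset_eq_degree,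
          ← Finset.card_map e]
        congr 1
        ext w
        simp only [SimpleGraph.mem_neighborFinset, SimpleGraph.map_adj, Finset.mem_map]
        constructor
        · rintro ⟨x, y, hxy, hx, rfl⟩
          exact ⟨y, (e.injective hx) ▸ hxy, rfl⟩
        · rintro ⟨y, hy, rfl⟩
          exact ⟨v, y, hy, rfl, rfl⟩
      have hdeg2 : ∀ v : Fin (m+1), v ∉ Set.range e → (H.map e).degree v = 0 := by
        intro v hv
        rw [← SimpleGraph.card_neighborFinset_eq_degree, Finset.card_eq_zero,
          Finset.eq_empty_iff_forall_notMem]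
        intro w hw
        simp only [SimpleGraph.mem_neighborFinset, SimpleGraph.map_adj] at hw
        obtain ⟨x, y, hxy, hx, rfl⟩ := hw
        exact hv ⟨x, hx⟩
      have hc : ∀ v (i : Fintype ((H.map e)ᶜ.neighborSet v)),
          @SimpleGraph.degree _ (H.map e)ᶜ v i = m - (H.map e).degree v := by
        intro v i
        have := SimpleGraph.degree_compl (G := H.map e) v
        simp only [Fintype.card_fin, Nat.add_sub_cancel] at this
        convert this
      refine ⟨(H.map e)ᶜ, ?_⟩
      have hH' : ∀ x, (∃ v, H.degree v = x) ↔ ∃ s ∈ S.erase m, m - s = x := by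
        intro x
        have := Set.ext_iff.1 hH x
        simpa only [Set.mem_range, Finset.mem_coe, Finset.mem_image] using this
      ext x
      simp only [Set.mem_range, Finset.mem_coe]
      constructor
      · rintro ⟨v, rfl⟩
        rw [hc]
        by_cases hv : v ∈ Set.range e
        · obtain ⟨w, rfl⟩ := hv
          rw [hdeg1]
          obtain ⟨s, hs, h⟩ := (hH' _).1 ⟨w, rfl⟩
          have hs' := (Finset.mem_erase.1 hs).2
          rw [← h, Nat.sub_sub_self (hmax s hs')]
          exact hs'
        · rw [hdeg2 v hv]; exact hm
      · intro hx
        by_cases hxm : x = m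
        · refine ⟨Fin.last m, ?_⟩
          rw [hc, hdeg2, hxm, Nat.sub_zero]
          rintro ⟨w, hw⟩
          have h1 := congrArg Fin.val hw
          have h2 := w.2
          simp [e] at h1
          omega
        · obtain ⟨v, hv⟩ := (hH' (m - x)).2 ⟨x, Finset.mem_erase.2 ⟨hxm, hx⟩, rfl⟩
          exact ⟨e v, by rw [hc, hdeg1, hv, Nat.sub_sub_self (hmax x hx)]⟩
    · rw [Finset.not_nonempty_iff_eq_empty] at hS
      have hSm : S = {m} := by
        rw [← Finset.insert_erase hm, hS]; rfl
      refine ⟨⊤, ?_⟩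
      have : ∀ (v : Fin (m+1)) (i : Fintype ((⊤ : SimpleGraph (Fin (m+1))).neighborSet v)),
          @SimpleGraph.degree _ (⊤ : SimpleGraph (Fin (m+1))) v i = m := by
        intro v i
        have := SimpleGraph.complete_graph_degree v
        simp only [Fintype.card_fin, Nat.add_sub_cancel] at this
        convert this
      simp only [this, hSm, Set.range_const, Finset.coe_singleton]

/-- Every non-empty finite set `D` of negative integers with minimum element `M`
is the signed degree set of some connected signed graph on exactly `|M| + 1` vertices. -/
theorem stmt_3 (D : Finset ℤ) (hne : D.Nonempty) (hneg : ∀ d ∈ D, d < 0) :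
    ∃ G : SignedGraph (Fin ((D.min' hne).natAbs + 1)),
      G.Connected ∧ G.degreeSet = ↑D := by
  classical
  have hM := D.min'_mem hne
  have hmin : ∀ x ∈ D, D.min' hne ≤ x := fun x hx => D.min'_le x hx
  generalize D.min' hne = M at hM hmin
  have hM0 := hneg M hM
  obtain ⟨H, hH⟩ := kpw_aux M.natAbs (D.image Int.natAbs)
    (by
      intro s hs
      obtain ⟨x, hx, rfl⟩ := Finset.mem_image.1 hs
      have := hneg x hx
      omega)
    (Finset.mem_image_of_mem _ hM)
    (by
      intro s hs
      obtain ⟨x, hx, rfl⟩ := Finset.mem_image.1 hs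
      have := hneg x hx
      have := hmin x hx
      omega)
  have hH' : ∀ x, (∃ v, H.degree v = x) ↔ ∃ s ∈ D, s.natAbs = x := by
    intro x
    have := Set.ext_iff.1 hH x
    simp only [Set.mem_range, Finset.mem_coe, Finset.mem_image] at this
    convert this
  refine ⟨⟨⊥, H, by simp⟩, ?_, ?_⟩
  · obtain ⟨v, hv⟩ := (hH' _).2 ⟨M, hM, rfl⟩
    have hadj : ∀ w, w ≠ v → H.Adj v w := by
      have h1 : H.neighborFinset v = Finset.univ.erase v := by
        apply Finset.eq_of_subset_of_card_le
        · intro w hw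
          rw [SimpleGraph.mem_neighborFinset] at hw
          simp [hw.ne']
        · rw [SimpleGraph.card_neighborFinset_eq_degree, hv, Finset.card_erase_of_mem (Finset.mem_univ _)]
          simp
      intro w hw
      rw [← SimpleGraph.mem_neighborFinset, h1]
      simp [hw]
    have hr : ∀ w, H.Reachable v w := by
      intro w
      by_cases h : w = v
      · rw [h]
      · exact (hadj w h).reachable
    unfold SignedGraph.Connected SignedGraph.underlying
    simp only [bot_sup_eq]
    exact { preconnected := fun a b => (hr a).symm.trans (hr b) }
  · have hs : ∀ v, SignedGraph.sdeg ⟨⊥, H, by simp⟩ v = -(H.degree v : ℤ) := by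
      intro v
      have : Nat.card {u // H.Adj v u} = H.degree v := by
        rw [← SimpleGraph.card_neighborSet_eq_degree, ← Nat.card_eq_fintype_card]
        rfl
      simp only [SignedGraph.sdeg, this]
      simp
    ext x
    simp only [SignedGraph.degreeSet, Set.mem_range, hs, Finset.mem_coe]
    constructor
    · rintro ⟨v, rfl⟩
      obtain ⟨s, hs, h⟩ := (hH' _).1 ⟨v, rfl⟩
      have := hneg s hs
      rw [← h]
      convert hs
      omega
    · intro hx
      obtain ⟨v, hv⟩ := (hH' _).2 ⟨x, hx, rfl⟩
      have := hneg x hx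
      exact ⟨v, by rw [hv]; omega⟩
end

section
/- For every non-empty finite set D of negative integers with minimum element M, the minimum possible number of vertices of a connected signed graph whose signed degree set is D equals |M| + 1. -/
/-- Degree of `i` in the threshold graph on `{0, …, n-1}` coded by `b`. -/
def thrDeg (b : ℕ → Bool) (n i : ℕ) : ℕ :=
  ((Finset.range n).filter (fun j => j ≠ i ∧ b (max i j) = true)).card

theorem thrDeg_ext (b : ℕ → Bool) (c : Bool) (n : ℕ) :
    ∃ b' : ℕ → Bool, (Finset.range (n + 1)).image (thrDeg b' (n + 1)) =
      insert (if c then n else 0)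
        (((Finset.range n).image (thrDeg b n)).image (fun x => x + if c then 1 else 0)) := by
  refine ⟨fun j => if j < n then b j else c, ?_⟩
  rw [Finset.range_add_one, Finset.image_insert, Finset.image_image]
  congr 1
  · unfold thrDeg
    rw [Finset.range_add_one, Finset.filter_insert]
    simp only [ne_eq, not_true_eq_false, false_and, if_false]
    have : ∀ j ∈ Finset.range n, (¬ j = n ∧ (if max n j < n then b (max n j) else c) = true)
        ↔ c = true := by
      intro j hj
      have hj := Finset.mem_range.1 hj
      have h1 : ¬ max n j < n := by omega
      have h2 : ¬ j = n := by omega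
      simp [h2]
    rw [Finset.filter_congr this]
    cases c <;> simp
  · apply Finset.image_congr
    intro i hi
    have hi : i < n := by simpa using hi
    unfold thrDeg
    simp only [Function.comp]
    rw [Finset.range_add_one, Finset.filter_insert]
    have : ∀ j ∈ Finset.range n,
        (j ≠ i ∧ (if max i j < n then b (max i j) else c) = true)
        ↔ (j ≠ i ∧ b (max i j) = true) := by
      intro j hj
      have hj := Finset.mem_range.1 hj
      have h1 : max i j < n := by omega
      simp only [h1, if_true]
    rw [Finset.filter_congr this]
    have h1 : ¬ max i n < n := by omega
    have h2 : n ≠ i := by omega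
    simp only [h1, if_false]
    cases c <;> simp [h2]

theorem thr_exists (m : ℕ) : ∀ S : Finset ℕ, (∀ x ∈ S, x ≤ m) →
    ((m = 0 ∧ S = {0}) ∨ (0 ∈ S ∧ m ∉ S) ∨ (0 ∉ S ∧ m ∈ S)) →
    ∃ b : ℕ → Bool, (Finset.range (m + 1)).image (thrDeg b (m + 1)) = S := by
  induction m with
  | zero =>
    intro S hS h
    have : S = {0} := by
      rcases h with h | h | h
      · exact h.2
      · exact absurd h.1 h.2
      · exact absurd h.2 h.1
    subst this
    refine ⟨fun _ => true, ?_⟩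
    decide
  | succ m ih =>
    intro S hS h
    have key : ∀ (c : Bool) (T : Finset ℕ), (∀ x ∈ T, x ≤ m) →
        ((m = 0 ∧ T = {0}) ∨ (0 ∈ T ∧ m ∉ T) ∨ (0 ∉ T ∧ m ∈ T)) →
        (insert (if c then m + 1 else 0) (T.image (fun x => x + if c then 1 else 0)) = S) →
        ∃ b : ℕ → Bool, (Finset.range (m + 1 + 1)).image (thrDeg b (m + 1 + 1)) = S := by
      intro c T h1 h2 h3
      obtain ⟨b, hb⟩ := ih T h1 h2
      obtain ⟨b', hb'⟩ := thrDeg_ext b c (m + 1)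
      exact ⟨b', by rw [hb', hb, h3]⟩
    rcases h with h | ⟨h0, hm⟩ | ⟨h0, hm⟩
    · omega
    · by_cases h2 : m ∈ S
      · by_cases hm0 : m = 0
        · refine key false {0} (by simp) (Or.inl ⟨hm0, rfl⟩) ?_
          subst hm0
          ext x
          have := hS x
          have : x = 1 → x ∉ S := by rintro rfl; exact hm
          have : x = 0 → x ∈ S := by rintro rfl; exact h0
          simp
          grind
        · refine key false (S.erase 0) ?_ (Or.inr (Or.inr ⟨by simp, by simp [hm0, h2]⟩)) ?_
          · intro x hx
            have hx := Finset.mem_of_mem_erase hx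
            have := hS x hx
            have : x ≠ m + 1 := by rintro rfl; exact hm hx
            omega
          · simp [h0]
      · refine key false S ?_ (Or.inr (Or.inl ⟨h0, h2⟩)) ?_
        · intro x hx
          have := hS x hx
          have : x ≠ m + 1 := by rintro rfl; exact hm hx
          omega
        · simp [h0]
    · have hpos : ∀ x ∈ S, x ≠ 0 := by rintro x hx rfl; exact h0 hx
      by_cases h1 : 1 ∈ S
      · by_cases hm0 : m = 0
        · refine key true {0} (by simp) (Or.inl ⟨hm0, rfl⟩) ?_
          subst hm0
          ext x
          have := hS x
          have := hpos x
          have : x = 1 → x ∈ S := by rintro rfl; exact h1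
          simp
          grind
        · refine key true ((S.erase (m + 1)).image (fun x => x - 1)) ?_ (Or.inr (Or.inl ⟨?_, ?_⟩)) ?_
          · intro x hx
            obtain ⟨y, hy, rfl⟩ := Finset.mem_image.1 hx
            have := hS y (Finset.mem_of_mem_erase hy)
            omega
          · exact Finset.mem_image.2 ⟨1, Finset.mem_erase.2 ⟨by omega, h1⟩, rfl⟩
          · intro hx
            obtain ⟨y, hy, hxy⟩ := Finset.mem_image.1 hx
            obtain ⟨hy1, hy2⟩ := Finset.mem_erase.1 hy
            have := hpos y hy2
            omega
          · rw [Finset.image_image]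
            have : (S.erase (m + 1)).image
                ((fun x => x + if (true : Bool) then 1 else 0) ∘ fun x => x - 1)
                = S.erase (m + 1) := by
              conv_rhs => rw [← Finset.image_id (s := S.erase (m + 1))]
              apply Finset.image_congr
              intro x hx
              have := hpos x (Finset.mem_of_mem_erase hx)
              simp
              omega
            rw [this]
            simp [Finset.insert_erase hm]
      · refine key true (S.image (fun x => x - 1)) ?_ (Or.inr (Or.inr ⟨?_, ?_⟩)) ?_
        · intro x hx
          obtain ⟨y, hy, rfl⟩ := Finset.mem_image.1 hx
          have := hS y hy
          omega
        · intro hx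
          obtain ⟨y, hy, hxy⟩ := Finset.mem_image.1 hx
          have := hpos y hy
          have : y = 1 := by omega
          subst this
          exact h1 hy
        · exact Finset.mem_image.2 ⟨m + 1, hm, rfl⟩
        · rw [Finset.image_image]
          have : S.image ((fun x => x + if (true : Bool) then 1 else 0) ∘ fun x => x - 1)
              = S := by
            conv_rhs => rw [← Finset.image_id (s := S)]
            apply Finset.image_congr
            intro x hx
            have := hpos x hx
            simp
            omega
          rw [this]
          simp [hm]

/-- The all-negative threshold signed graph. -/
def thrGraph (b : ℕ → Bool) (n : ℕ) : SignedGraph (Fin n) where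
  pos := ⊥
  neg :=
    { Adj := fun i j => (j : ℕ) ≠ i ∧ b (max (i : ℕ) j) = true
      symm := ⟨fun i j h => ⟨h.1.symm, by rw [max_comm]; exact h.2⟩⟩
      loopless := ⟨fun i h => h.1 rfl⟩ }
  disjoint := by
    rintro u v ⟨h, _⟩
    exact h

theorem thrGraph_sdeg (b : ℕ → Bool) (n : ℕ) (i : Fin n) :
    (thrGraph b n).sdeg i = -(thrDeg b n i : ℤ) := by
  unfold SignedGraph.sdeg
  have h1 : Nat.card {u : Fin n // (thrGraph b n).pos.Adj i u} = 0 := by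
    have : IsEmpty {u : Fin n // (thrGraph b n).pos.Adj i u} := ⟨fun u => u.2⟩
    exact Nat.card_of_isEmpty
  have h2 : Nat.card {u : Fin n // (thrGraph b n).neg.Adj i u} = thrDeg b n i := by
    unfold thrDeg
    rw [← Fintype.card_coe, ← Nat.card_eq_fintype_card]
    refine Nat.card_congr
      { toFun := fun u => ⟨u.1, Finset.mem_filter.2 ⟨Finset.mem_range.2 u.1.2, u.2⟩⟩
        invFun := fun u => ⟨⟨u.1, Finset.mem_range.1 (Finset.mem_filter.1 u.2).1⟩,
          (Finset.mem_filter.1 u.2).2⟩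
        left_inv := fun u => rfl
        right_inv := fun u => rfl }
  rw [h1, h2]; simp

/-- For every non-empty finite set `D` of negative integers with minimum element `M`,
the minimum possible order of a connected signed graph with signed degree set `D`
is `|M| + 1`. -/
theorem stmt_5 (D : Finset ℤ) (hne : D.Nonempty) (hneg : ∀ d ∈ D, d < 0) :
    IsLeast {n : ℕ | ∃ G : SignedGraph (Fin n), G.Connected ∧ G.degreeSet = ↑D}
      ((D.min' hne).natAbs + 1) := by
  have hM := D.min'_mem hne
  have hMle : ∀ d ∈ D, D.min' hne ≤ d := fun d hd => D.min'_le d hd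
  generalize D.min' hne = M at hM hMle
  have hM0 := hneg M hM
  constructor
  · obtain ⟨b, hb⟩ := thr_exists M.natAbs (D.image Int.natAbs) (by
      intro x hx
      obtain ⟨d, hd, rfl⟩ := Finset.mem_image.1 hx
      have := hMle d hd
      have := hneg d hd
      omega) (Or.inr (Or.inr ⟨by
        intro hx
        obtain ⟨d, hd, h⟩ := Finset.mem_image.1 hx
        have := hneg d hd
        omega, Finset.mem_image_of_mem _ hM⟩))
    refine ⟨thrGraph b (M.natAbs + 1), ?_, ?_⟩
    · have : M.natAbs ∈ (Finset.range (M.natAbs + 1)).image (thrDeg b (M.natAbs + 1)) := by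
        rw [hb]; exact Finset.mem_image_of_mem _ hM
      obtain ⟨i, hi, hd⟩ := Finset.mem_image.1 this
      have hsub : (Finset.range (M.natAbs + 1)).filter (fun j => j ≠ i ∧ b (max i j) = true)
          ⊆ (Finset.range (M.natAbs + 1)).erase i := by
        intro j hj
        have := Finset.mem_filter.1 hj
        exact Finset.mem_erase.2 ⟨this.2.1, this.1⟩
      have heq := Finset.eq_of_subset_of_card_le hsub (by
        rw [Finset.card_erase_of_mem hi, Finset.card_range]
        unfold thrDeg at hd
        omega)
      have hall : ∀ v : Fin (M.natAbs + 1),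
          (thrGraph b (M.natAbs + 1)).underlying.Reachable ⟨i, Finset.mem_range.1 hi⟩ v := by
        intro v
        by_cases hv : (v : ℕ) = i
        · have : (⟨i, Finset.mem_range.1 hi⟩ : Fin (M.natAbs + 1)) = v := Fin.ext hv.symm
          rw [this]
        · apply SimpleGraph.Adj.reachable
          right
          have : (v : ℕ) ∈ (Finset.range (M.natAbs + 1)).erase i :=
            Finset.mem_erase.2 ⟨hv, Finset.mem_range.2 v.2⟩
          rw [← heq] at this
          exact (Finset.mem_filter.1 this).2
      exact { preconnected := fun u v => (hall u).symm.trans (hall v), nonempty := ⟨0⟩ }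
    · ext x
      simp only [SignedGraph.degreeSet, Set.mem_range, thrGraph_sdeg, Finset.mem_coe]
      constructor
      · rintro ⟨i, rfl⟩
        have : thrDeg b (M.natAbs + 1) i ∈ D.image Int.natAbs := by
          rw [← hb]; exact Finset.mem_image_of_mem _ (Finset.mem_range.2 i.2)
        obtain ⟨d, hd, h⟩ := Finset.mem_image.1 this
        have := hneg d hd
        have : -(thrDeg b (M.natAbs + 1) i : ℤ) = d := by omega
        rw [this]; exact hd
      · intro hx
        have : x.natAbs ∈ D.image Int.natAbs := Finset.mem_image_of_mem _ hx
        rw [← hb] at this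
        obtain ⟨i, hi, h⟩ := Finset.mem_image.1 this
        have := hneg x hx
        refine ⟨⟨i, Finset.mem_range.1 hi⟩, ?_⟩
        dsimp only
        omega
  · rintro n ⟨G, -, hG⟩
    have : M ∈ G.degreeSet := by rw [hG]; exact hM
    obtain ⟨v, hv⟩ := this
    unfold SignedGraph.sdeg at hv
    classical
    have h1 := G.neg.degree_lt_card_verts v
    rw [← SimpleGraph.card_neighborSet_eq_degree, ← Nat.card_eq_fintype_card,
      Fintype.card_fin] at h1
    have h2 : Nat.card (G.neg.neighborSet v) = Nat.card {u : Fin n // G.neg.Adj v u} := rfl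
    omega
end

section
/- Every non-empty finite set D of integers is the signed degree set of some connected signed graph. -/
open Classical in
theorem SignedGraph.sdeg_eq_sum {V : Type*} [Fintype V] (G : SignedGraph V) (v : V) :
    G.sdeg v = ∑ u, ((if G.pos.Adj v u then (1:ℤ) else 0) - (if G.neg.Adj v u then 1 else 0)) := by
  unfold SignedGraph.sdeg
  rw [Finset.sum_sub_distrib, Nat.card_eq_fintype_card, Nat.card_eq_fintype_card,
    Fintype.card_subtype, Fintype.card_subtype, Finset.sum_boole, Finset.sum_boole]

/-- Relabelling of the vertices by `Fin n`. -/
theorem SignedGraph.exists_fin {V : Type*} [Fintype V] (G : SignedGraph V) (hG : G.Connected) :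
    ∃ (n : ℕ) (H : SignedGraph (Fin n)), H.Connected ∧ H.degreeSet = G.degreeSet := by
  let e := Fintype.equivFin V
  let H : SignedGraph (Fin (Fintype.card V)) :=
    ⟨G.pos.comap e.symm, G.neg.comap e.symm, fun u v h => G.disjoint _ _ h⟩
  have hs : ∀ v, H.sdeg v = G.sdeg (e.symm v) := by
    intro v
    unfold SignedGraph.sdeg
    congr 2
    · exact Nat.card_congr (e.symm.subtypeEquiv fun a => Iff.rfl)
    · exact Nat.card_congr (e.symm.subtypeEquiv fun a => Iff.rfl)
  refine ⟨_, H, ?_, ?_⟩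
  · have i : H.underlying ≃g G.underlying := ⟨e.symm, by intro a b; exact Iff.rfl⟩
    exact i.connected_iff.2 hG
  · unfold SignedGraph.degreeSet
    rw [show H.sdeg = G.sdeg ∘ e.symm from funext hs]
    exact e.symm.surjective.range_comp _

/-- The vertex set: for each `i`, two copies of a clique on `|f i| + 1` vertices. -/
abbrev BlockV {I : Type} (f : I → ℤ) : Type := Σ i : I, Fin ((f i).natAbs + 1) × Bool

/-- Cliques of sign `f i` in each block; between distinct blocks all edges, signed so that
they cancel at each vertex. -/
def blockGraph {I : Type} (f : I → ℤ) : SignedGraph (BlockV f) where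
  pos :=
    { Adj := fun p q => (p.1 = q.1 ∧ p.2.2 = q.2.2 ∧ p ≠ q ∧ 0 ≤ f p.1) ∨
        (p.1 ≠ q.1 ∧ p.2.2 = q.2.2)
      symm := ⟨by
        rintro p q (⟨h1, h2, h3, h4⟩ | ⟨h1, h2⟩)
        · exact Or.inl ⟨h1.symm, h2.symm, h3.symm, h1 ▸ h4⟩
        · exact Or.inr ⟨Ne.symm h1, h2.symm⟩⟩
      loopless := ⟨by
        rintro p (⟨h1, h2, h3, h4⟩ | ⟨h1, h2⟩)
        · exact h3 rfl
        · exact h1 rfl⟩ }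
  neg :=
    { Adj := fun p q => (p.1 = q.1 ∧ p.2.2 = q.2.2 ∧ p ≠ q ∧ f p.1 < 0) ∨
        (p.1 ≠ q.1 ∧ p.2.2 ≠ q.2.2)
      symm := ⟨by
        rintro p q (⟨h1, h2, h3, h4⟩ | ⟨h1, h2⟩)
        · exact Or.inl ⟨h1.symm, h2.symm, h3.symm, h1 ▸ h4⟩
        · exact Or.inr ⟨Ne.symm h1, Ne.symm h2⟩⟩
      loopless := ⟨by
        rintro p (⟨h1, h2, h3, h4⟩ | ⟨h1, h2⟩)
        · exact h3 rfl
        · exact h1 rfl⟩ }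
  disjoint := by
    rintro p q ⟨⟨h1, h2, h3, h4⟩ | ⟨h1, h2⟩, ⟨k1, k2, k3, k4⟩ | ⟨k1, k2⟩⟩
    · omega
    · exact k1 h1
    · exact h1 k1
    · exact k2 h2

theorem blockGraph_adj {I : Type} (f : I → ℤ) (p q : BlockV f) (h : p.1 ≠ q.1) :
    (blockGraph f).underlying.Adj p q := by
  by_cases hb : p.2.2 = q.2.2
  · exact Or.inl (Or.inr ⟨h, hb⟩)
  · exact Or.inr (Or.inr ⟨h, hb⟩)

theorem blockGraph_connected {I : Type} [Nontrivial I] (f : I → ℤ) :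
    (blockGraph f).Connected := by
  have : Nonempty (BlockV f) := ⟨⟨Classical.arbitrary I, 0, true⟩⟩
  refine ⟨fun p q => ?_⟩
  by_cases h : p.1 = q.1
  · obtain ⟨j, hj⟩ := exists_ne p.1
    let r : BlockV f := ⟨j, 0, true⟩
    exact (blockGraph_adj f p r hj.symm).reachable.trans
      (blockGraph_adj f r q (h ▸ hj)).reachable
  · exact (blockGraph_adj f p q h).reachable

theorem blockGraph_sdeg {I : Type} [Fintype I] (f : I → ℤ) (p : BlockV f) :
    (blockGraph f).sdeg p = f p.1 := by
  classical
  obtain ⟨i, x, b⟩ := p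
  rw [SignedGraph.sdeg_eq_sum, Fintype.sum_sigma, Finset.sum_eq_single i]
  · have key : ∀ y : Fin ((f i).natAbs + 1), ∀ c : Bool,
        ((if (blockGraph f).pos.Adj ⟨i, x, b⟩ ⟨i, y, c⟩ then (1:ℤ) else 0) -
          (if (blockGraph f).neg.Adj ⟨i, x, b⟩ ⟨i, y, c⟩ then 1 else 0)) =
        if c = b then (if y = x then 0 else if 0 ≤ f i then 1 else -1) else 0 := by
      intro y c
      simp only [blockGraph]
      by_cases hc : c = b
      · subst hc
        by_cases hy : y = x
        · subst hy; simp
        · by_cases h0 : 0 ≤ f i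
          · simp [hy, Ne.symm hy, h0]
          · simp [hy, Ne.symm hy, h0, not_le.1 h0]
      · simp [hc, Ne.symm hc]
    rw [Fintype.sum_prod_type]
    simp only [key, Finset.sum_ite_eq', Finset.sum_ite_eq, Finset.mem_univ, if_true]
    rw [← Finset.sum_erase_add _ _ (Finset.mem_univ x), Finset.sum_congr rfl
      (g := fun _ => if 0 ≤ f i then (1:ℤ) else -1)
      (fun y hy => if_neg (Finset.ne_of_mem_erase hy))]
    rw [Finset.sum_const, Finset.card_erase_of_mem (Finset.mem_univ x)]
    simp
    split_ifs with h
    · simp [abs_of_nonneg h]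
    · simp [abs_of_neg (not_le.1 h)]
  · intro j _ hj
    rw [Fintype.sum_prod_type]
    refine Finset.sum_eq_zero fun y _ => ?_
    simp only [blockGraph]
    cases b <;> simp [Ne.symm hj]
  · simp

/-- Every non-empty finite set of integers is the signed degree set of some
connected signed graph. -/
theorem stmt_6 (D : Finset ℤ) (hne : D.Nonempty) :
    ∃ (n : ℕ) (G : SignedGraph (Fin n)), G.Connected ∧ G.degreeSet = ↑D := by
  have : Nonempty D := hne.to_subtype
  let f : D × Bool → ℤ := fun i => (i.1 : ℤ)
  obtain ⟨n, H, hc, hd⟩ := (blockGraph f).exists_fin (blockGraph_connected f)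
  refine ⟨n, H, hc, hd.trans ?_⟩
  ext z
  constructor
  · rintro ⟨p, rfl⟩
    rw [blockGraph_sdeg]
    exact p.1.1.2
  · intro hz
    exact ⟨⟨(⟨z, hz⟩, true), 0, true⟩, blockGraph_sdeg f _⟩
end

section
/- Every finite set D of non-negative integers that contains 0 and at least one positive integer is the signed degree set of some connected signed graph. -/
namespace SignedGraph

/-- Pull back a signed graph along an equivalence. -/
def pull {V W : Type*} (e : W ≃ V) (G : SignedGraph V) : SignedGraph W where
  pos := G.pos.comap e
  neg := G.neg.comap e
  disjoint u v := G.disjoint (e u) (e v)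

lemma pull_sdeg {V W : Type*} (e : W ≃ V) (G : SignedGraph V) (w : W) :
    (G.pull e).sdeg w = G.sdeg (e w) := by
  unfold sdeg
  rw [Nat.card_congr (e.subtypeEquiv (p := fun u => (G.pull e).pos.Adj w u)
      (q := fun u => G.pos.Adj (e w) u) (fun _ => Iff.rfl)),
    Nat.card_congr (e.subtypeEquiv (p := fun u => (G.pull e).neg.Adj w u)
      (q := fun u => G.neg.Adj (e w) u) (fun _ => Iff.rfl))]

lemma pull_connected {V W : Type*} (e : W ≃ V) (G : SignedGraph V) (h : G.Connected) :
    (G.pull e).Connected := by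
  have i : (G.pull e).underlying ≃g G.underlying := ⟨e, Iff.rfl⟩
  exact i.connected_iff.2 h

/-- Blocks of size `d + 1`, one for each `d ∈ D`. -/
abbrev Blk (D : Finset ℤ) := Σ d : D, Fin (d.1.natAbs + 1)

/-- Two copies of the complete positive graph on all blocks, with negative edges between
different blocks in opposite copies. -/
def build (D : Finset ℤ) : SignedGraph (Blk D × Bool) where
  pos := { Adj := fun x y => x.2 = y.2 ∧ x.1 ≠ y.1
           symm := ⟨fun _ _ h => ⟨h.1.symm, h.2.symm⟩⟩
           loopless := ⟨fun _ h => h.2 rfl⟩ }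
  neg := { Adj := fun x y => x.2 ≠ y.2 ∧ x.1.1 ≠ y.1.1
           symm := ⟨fun _ _ h => ⟨h.1.symm, h.2.symm⟩⟩
           loopless := ⟨fun _ h => h.2 rfl⟩ }
  disjoint := fun _ _ h => h.2.1 h.1.1

lemma build_sdeg (D : Finset ℤ) (v : Blk D × Bool) :
    (build D).sdeg v = (v.1.1.1.natAbs : ℤ) := by
  obtain ⟨x, i⟩ := v
  have e1 : {u // (build D).pos.Adj (x, i) u} ≃ {y : Blk D // ¬ y = x} :=
    { toFun := fun u => ⟨u.1.1, fun h => u.2.2 h.symm⟩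
      invFun := fun y => ⟨(y.1, i), rfl, fun h => y.2 h.symm⟩
      left_inv := by
        rintro ⟨⟨y, j⟩, h1, h2⟩
        have h1 : i = j := h1
        subst h1; rfl
      right_inv := fun _ => rfl }
  have e2 : {u // (build D).neg.Adj (x, i) u} ≃ {y : Blk D // ¬ y.1 = x.1} :=
    { toFun := fun u => ⟨u.1.1, fun h => u.2.2 h.symm⟩
      invFun := fun y => ⟨(y.1, !i), by simp [build], fun h => y.2 h.symm⟩
      left_inv := by
        rintro ⟨⟨y, j⟩, h1, h2⟩
        have h1 : i ≠ j := h1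
        have : j = !i := by cases i <;> cases j <;> simp_all
        subst this; rfl
      right_inv := fun _ => rfl }
  have e3 : {y : Blk D // y.1 = x.1} ≃ Fin (x.1.1.natAbs + 1) := 
    { toFun := fun y => y.2 ▸ y.1.2
      invFun := fun p => ⟨⟨x.1, p⟩, rfl⟩
      left_inv := by
        obtain ⟨d, p⟩ := x
        rintro ⟨⟨d', q⟩, h⟩
        have h : d' = d := h
        subst h; rfl
      right_inv := fun _ => rfl }
  have c3 := Fintype.card_congr e3
  have c4 : Fintype.card {y : Blk D // y.1 = x.1} ≤ Fintype.card (Blk D) :=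
    Fintype.card_subtype_le _
  unfold sdeg
  rw [Nat.card_congr e1, Nat.card_congr e2, Nat.card_eq_fintype_card, Nat.card_eq_fintype_card,
    Fintype.card_subtype_compl, Fintype.card_subtype_compl, Fintype.card_subtype_eq]
  rw [Fintype.card_fin] at c3
  dsimp only
  omega

lemma build_connected (D : Finset ℤ) (h0 : (0 : ℤ) ∈ D) (hpos : ∃ d ∈ D, 0 < d) :
    (build D).Connected := by
  obtain ⟨d, hd, hd0⟩ := hpos
  have same : ∀ (x y : Blk D) (i : Bool), (build D).underlying.Reachable (x, i) (y, i) := by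
    intro x y i
    by_cases h : x = y
    · rw [h]
    · exact SimpleGraph.Adj.reachable (Or.inl ⟨rfl, h⟩)
  have diff : ∀ (x y : Blk D) (i j : Bool), (build D).underlying.Reachable (x, i) (y, j) := by
    intro x y i j
    by_cases hij : i = j
    · subst hij; exact same x y i
    · have hne : (⟨0, h0⟩ : D) ≠ ⟨d, hd⟩ := fun h => hd0.ne (congrArg Subtype.val h)
      have a : (build D).underlying.Adj ((⟨⟨0, h0⟩, 0⟩ : Blk D), i) ((⟨⟨d, hd⟩, 0⟩ : Blk D), j) :=
        Or.inr ⟨hij, hne⟩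
      exact ((same _ _ _).trans a.reachable).trans (same _ _ _)
  have : Nonempty (Blk D × Bool) := ⟨(⟨⟨0, h0⟩, 0⟩, true)⟩
  exact SimpleGraph.Connected.mk fun u v => diff u.1 v.1 u.2 v.2

end SignedGraph

open SignedGraph in
/-- Every finite set of non-negative integers containing `0` and at least one
positive integer is the signed degree set of some connected signed graph. -/
theorem stmt_8 (D : Finset ℤ) (h0 : (0 : ℤ) ∈ D) (hnonneg : ∀ d ∈ D, 0 ≤ d)
    (hpos : ∃ d ∈ D, 0 < d) :
    ∃ (n : ℕ) (G : SignedGraph (Fin n)), G.Connected ∧ G.degreeSet = ↑D := by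
  let e := (Fintype.equivFin (Blk D × Bool)).symm
  refine ⟨_, (build D).pull e, pull_connected e _ (build_connected D h0 hpos), ?_⟩
  ext z
  constructor
  · rintro ⟨w, rfl⟩
    rw [pull_sdeg, build_sdeg, Int.natAbs_of_nonneg (hnonneg _ (e w).1.1.2)]
    exact (e w).1.1.2
  · intro hz
    refine ⟨e.symm (⟨⟨z, hz⟩, 0⟩, true), ?_⟩
    rw [pull_sdeg, build_sdeg, Equiv.apply_symm_apply]
    exact Int.natAbs_of_nonneg (hnonneg z hz)
end

section
/- If D is a finite set of non-zero integers containing at least one positive integer and at least one negative integer, then D is the signed degree set of some connected signed graph. -/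
/-- Build a signed graph on `Fin n` from a symmetric weight matrix. -/
theorem build_of_weight {V : Type} [Fintype V] [DecidableEq V] [Nonempty V] (w : V → V → ℤ)
    (hs : ∀ a b, w a b = w b a) (h0 : ∀ a, w a a = 0)
    (hv : ∀ a b, w a b = 0 ∨ w a b = 1 ∨ w a b = -1)
    (hc : ∀ a b, Relation.ReflTransGen (fun x y => w x y ≠ 0) a b) :
    ∃ (n : ℕ) (G : SignedGraph (Fin n)), G.Connected ∧
      G.degreeSet = Set.range (fun a => ∑ b, w a b) := by
  classical
  obtain f := (Fintype.equivFin V).symm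
  refine ⟨Fintype.card V, ⟨⟨fun a b => w (f a) (f b) = 1, ⟨fun a b h => by rw [hs]; exact h⟩,
    ⟨fun a h => by simp [h0] at h⟩⟩, ⟨fun a b => w (f a) (f b) = -1,
    ⟨fun a b h => by rw [hs]; exact h⟩, ⟨fun a h => by simp [h0] at h⟩⟩, ?_⟩, ?_, ?_⟩
  · rintro u v ⟨h1, h2⟩
    simp only at h1 h2
    omega
  · unfold SignedGraph.Connected
    rw [SimpleGraph.connected_iff]
    refine ⟨fun a b => ?_, f.symm.nonempty_congr.mp inferInstance⟩
    have := hc (f a) (f b)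
    generalize hx : f b = x at this
    induction this generalizing b with
    | refl => rw [f.injective hx]
    | @tail y z _ h ih =>
      refine (ih (f.symm y) (by simp)).trans (SimpleGraph.Adj.reachable ?_)
      rw [← hx] at h
      have := hv y (f b)
      simp only [SignedGraph.underlying, SimpleGraph.sup_adj, Equiv.apply_symm_apply]
      tauto
  · unfold SignedGraph.degreeSet
    rw [← f.surjective.range_comp]
    congr 1
    funext a
    simp only [SignedGraph.sdeg, Function.comp]
    rw [← f.sum_comp, Nat.card_eq_fintype_card, Nat.card_eq_fintype_card, Fintype.card_subtype,
      Fintype.card_subtype, Finset.card_filter, Finset.card_filter]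
    push_cast
    rw [← Finset.sum_sub_distrib]
    refine Finset.sum_congr rfl fun b _ => ?_
    rcases hv (f a) (f b) with h | h | h <;> simp [h]

/-- The weight between two copies. -/
def cliqueWeight (D : Finset ℤ) (x y : (d : D) × Fin (d.1.natAbs + 1)) : ℤ :=
  if x.1 = y.1 then (if x.2.1 = y.2.1 then 0 else Int.sign x.1.1)
  else if x.2.1 ≤ 1 ∧ y.2.1 ≤ 1 then (if x.2.1 = y.2.1 then 1 else -1) else 0

theorem cross_sum (i n : ℕ) :
    ∑ j ∈ Finset.range (n + 1 + 1), (if i ≤ 1 ∧ j ≤ 1 then (if i = j then 1 else -1) else 0 : ℤ)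
      = 0 := by
  induction n with
  | zero =>
    rcases i with _ | _ | i <;> simp [Finset.sum_range_succ]
  | succ n ih => rw [Finset.sum_range_succ, ih]; simp

theorem cliqueWeight_sum (D : Finset ℤ) (hnz : ∀ d ∈ D, d ≠ 0)
    (x : (d : D) × Fin (d.1.natAbs + 1)) : ∑ y, cliqueWeight D x y = x.1.1 := by
  obtain ⟨d, i⟩ := x
  rw [Fintype.sum_sigma, Finset.sum_eq_single d]
  · have : ∀ j : Fin (d.1.natAbs + 1), cliqueWeight D ⟨d, i⟩ ⟨d, j⟩ =
        Int.sign d.1 - (if i = j then Int.sign d.1 else 0) := by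
      intro j
      by_cases h : i = j
      · simp [cliqueWeight, h]
      · have : i.1 ≠ j.1 := fun h' => h (Fin.ext h')
        simp [cliqueWeight, h, this]
    simp only [this, Finset.sum_sub_distrib, Finset.sum_ite_eq, Finset.mem_univ, if_true]
    simp only [Finset.sum_const, Finset.card_univ, Fintype.card_fin, nsmul_eq_mul]
    have := Int.sign_mul_natAbs d.1
    push_cast at this ⊢
    linarith
  · intro e _ hne
    have h : ∀ j : Fin (e.1.natAbs + 1), cliqueWeight D ⟨d, i⟩ ⟨e, j⟩ =
      (fun j : ℕ => (if i.1 ≤ 1 ∧ j ≤ 1 then (if i.1 = j then 1 else -1) else 0 : ℤ)) j.1 := by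
      intro j
      simp [cliqueWeight, Ne.symm hne]
    rw [Finset.sum_congr rfl fun j _ => h j, Fin.sum_univ_eq_sum_range
      (fun j : ℕ => (if i.1 ≤ 1 ∧ j ≤ 1 then (if i.1 = j then 1 else -1) else 0 : ℤ))]
    obtain ⟨n, hn⟩ : ∃ n, e.1.natAbs = n + 1 :=
      Nat.exists_eq_succ_of_ne_zero (by simpa using hnz _ e.2)
    rw [hn]
    exact cross_sum _ _
  · simp

/-- Every finite set of non-zero integers containing at least one positive and at
least one negative integer is the signed degree set of some connected signed graph. -/
theorem stmt_10 (D : Finset ℤ) (hnz : ∀ d ∈ D, d ≠ 0)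
    (hpos : ∃ d ∈ D, 0 < d) (hneg : ∃ d ∈ D, d < 0) :
    ∃ (n : ℕ) (G : SignedGraph (Fin n)), G.Connected ∧ G.degreeSet = ↑D := by
  obtain ⟨d0, hd0, _⟩ := hpos
  have : Nonempty ((d : D) × Fin (d.1.natAbs + 1)) := ⟨⟨⟨d0, hd0⟩, 0⟩⟩
  have hdiag : ∀ x : (d : D) × Fin (d.1.natAbs + 1),
      Relation.ReflTransGen (fun x y => cliqueWeight D x y ≠ 0) x ⟨x.1, 0⟩ ∧
      Relation.ReflTransGen (fun x y => cliqueWeight D x y ≠ 0) ⟨x.1, 0⟩ x := by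
    rintro ⟨d, i⟩
    by_cases h : i = 0
    · subst h
      exact ⟨.refl, .refl⟩
    · have h' : i.1 ≠ 0 := fun h' => h (Fin.ext h')
      have hd := hnz _ d.2
      exact ⟨.single (by simp [cliqueWeight, h, hd]),
        .single (by simp [cliqueWeight, hd, Ne.symm h'])⟩
  obtain ⟨n, G, hG, hdeg⟩ := build_of_weight (cliqueWeight D)
    (by
      intro a b
      unfold cliqueWeight
      by_cases h : a.1 = b.1
      · simp [h, eq_comm]
      · simp [h, Ne.symm h, eq_comm, and_comm])
    (by intro a; simp [cliqueWeight])
    (by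
      intro a b
      unfold cliqueWeight
      have := Int.sign_trichotomy a.1.1
      split_ifs <;> simp
      simp at this
      tauto)
    (by
      intro a b
      refine (hdiag a).1.trans (Relation.ReflTransGen.trans ?_ (hdiag b).2)
      by_cases h : a.1 = b.1
      · rw [h]
      · exact .single (by simp [cliqueWeight, h]))
  refine ⟨n, G, hG, ?_⟩
  rw [hdeg]
  ext z
  simp only [cliqueWeight_sum D hnz, Set.mem_range, Finset.mem_coe]
  constructor
  · rintro ⟨x, rfl⟩
    exact x.1.2
  · intro hz
    exact ⟨⟨⟨z, hz⟩, 0⟩, rfl⟩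
end

section
/- If D is a finite set of integers containing 0, at least one positive integer and at least one negative integer, then D is the signed degree set of some connected signed graph. -/
/-- Realisation of a symmetric sign function as a signed graph on `Fin n`. -/
theorem exists_of_sign {V : Type} [Fintype V] [DecidableEq V] (s : V → V → ℤ)
    (hs : ∀ x y, s x y = s y x) (hd : ∀ x, s x x = 0)
    (hv : ∀ x y, s x y = 0 ∨ s x y = 1 ∨ s x y = -1)
    (hub : V) (hc : ∀ x, Relation.ReflTransGen (fun a b => s a b ≠ 0) hub x) :
    ∃ (n : ℕ) (G : SignedGraph (Fin n)), G.Connected ∧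
      G.degreeSet = Set.range (fun x => ∑ y, s x y) := by
  classical
  let e := Fintype.equivFin V
  let G : SignedGraph (Fin (Fintype.card V)) :=
    { pos :=
        { Adj := fun a b => s (e.symm a) (e.symm b) = 1
          symm := ⟨fun a b h => by rw [hs]; exact h⟩
          loopless := ⟨fun a h => by rw [hd] at h; omega⟩ }
      neg :=
        { Adj := fun a b => s (e.symm a) (e.symm b) = -1
          symm := ⟨fun a b h => by rw [hs]; exact h⟩
          loopless := ⟨fun a h => by rw [hd] at h; omega⟩ }
      disjoint := fun u v h => by
        have h1 : s (e.symm u) (e.symm v) = 1 := h.1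
        have h2 : s (e.symm u) (e.symm v) = -1 := h.2
        omega }
  have hdeg : ∀ a, G.sdeg a = ∑ y, s (e.symm a) y := by
    intro a
    have h1 : G.sdeg a = (Nat.card {b // s (e.symm a) (e.symm b) = 1} : ℤ)
        - (Nat.card {b // s (e.symm a) (e.symm b) = -1} : ℤ) := rfl
    rw [h1, ← Equiv.sum_comp e.symm, Nat.card_eq_fintype_card, Nat.card_eq_fintype_card,
      Fintype.card_subtype, Fintype.card_subtype, Finset.card_filter, Finset.card_filter]
    push_cast
    rw [← Finset.sum_sub_distrib]
    refine Finset.sum_congr rfl fun b _ => ?_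
    rcases hv (e.symm a) (e.symm b) with h | h | h <;> simp [h]
  refine ⟨_, G, ?_, ?_⟩
  · have hr : ∀ x, G.underlying.Reachable (e hub) (e x) := by
      intro x
      induction hc x with
      | refl => exact SimpleGraph.Reachable.refl _
      | @tail b c _ hbc ih =>
        refine ih.trans (SimpleGraph.Adj.reachable ?_)
        change s (e.symm (e b)) (e.symm (e c)) = 1 ∨ s (e.symm (e b)) (e.symm (e c)) = -1
        simp only [Equiv.symm_apply_apply]
        rcases hv b c with h | h
        · exact absurd h hbc
        · exact h
    have hr' : ∀ a, G.underlying.Reachable (e hub) a := fun a => by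
      simpa using hr (e.symm a)
    have : Nonempty (Fin (Fintype.card V)) := ⟨e hub⟩
    exact SimpleGraph.Connected.mk fun a b => (hr' a).symm.trans (hr' b)
  · ext z
    simp only [SignedGraph.degreeSet, Set.mem_range, hdeg]
    constructor
    · rintro ⟨a, ha⟩; exact ⟨_, ha⟩
    · rintro ⟨x, hx⟩; exact ⟨e x, by simpa using hx⟩

/-- Vertices other than the two hub vertices. -/
abbrev Blk (D : Finset ℤ) : Type := (Σ d : D, Fin (d : ℤ).natAbs) × Bool

/-- Two hub vertices, joined with signs `±1` to the two sides of the complete bipartite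
graphs `K_{|d|,|d|}`, all of whose edges have the sign of `d`. -/
def sgn (D : Finset ℤ) : Bool ⊕ Blk D → Bool ⊕ Blk D → ℤ
  | .inl _, .inl _ => 0
  | .inl i, .inr w => if i = w.2 then 1 else -1
  | .inr w, .inl i => if i = w.2 then 1 else -1
  | .inr v, .inr w => if v.1.1 = w.1.1 ∧ v.2 ≠ w.2 then (v.1.1 : ℤ).sign else 0

theorem sgn_hub (D : Finset ℤ) (i : Bool) : ∑ y, sgn D (.inl i) y = 0 := by
  simp only [Fintype.sum_sum_type, sgn, Fintype.sum_prod_type, Fintype.sum_bool]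
  cases i <;> simp

theorem sgn_blk (D : Finset ℤ) (v : Blk D) : ∑ y, sgn D (.inr v) y = (v.1.1 : ℤ) := by
  obtain ⟨⟨d, i⟩, b⟩ := v
  have h : ∀ b', ∑ x : (Σ d : D, Fin (d : ℤ).natAbs),
      (if d = x.1 ∧ b ≠ b' then (d : ℤ).sign else 0) = if b ≠ b' then (d : ℤ) else 0 := by
    intro b'
    rw [Fintype.sum_sigma]
    by_cases hb : b = b'
    · simp [hb]
    · rw [Finset.sum_eq_single d]
      · simp only [hb, ne_eq, not_false_eq_true, and_self, if_true, Finset.sum_const,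
          Finset.card_univ, Fintype.card_fin, nsmul_eq_mul]
        rw [mul_comm]; exact Int.sign_mul_natAbs _
      · intro d' _ hd'
        simp [Ne.symm hd']
      · simp
  simp only [Fintype.sum_sum_type, sgn]
  rw [Fintype.sum_prod_type_right]
  simp only [h, Fintype.sum_bool]
  cases b <;> simp

/-- Every finite set of integers containing `0`, at least one positive integer and
at least one negative integer is the signed degree set of some connected signed graph. -/
theorem stmt_11 (D : Finset ℤ) (h0 : (0 : ℤ) ∈ D)
    (hpos : ∃ d ∈ D, 0 < d) (hneg : ∃ d ∈ D, d < 0) :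
    ∃ (n : ℕ) (G : SignedGraph (Fin n)), G.Connected ∧ G.degreeSet = ↑D := by
  classical
  obtain ⟨d, hd, hdp⟩ := hpos
  let w : Σ d : D, Fin (d : ℤ).natAbs := ⟨⟨d, hd⟩, ⟨0, by simp only; omega⟩⟩
  have hne : ∀ (i : Bool) (v : Blk D), sgn D (.inl i) (.inr v) ≠ 0 := by
    intro i v; simp only [sgn]; split_ifs <;> simp
  have hne' : ∀ (i : Bool) (v : Blk D), sgn D (.inr v) (.inl i) ≠ 0 := by
    intro i v; simp only [sgn]; split_ifs <;> simp
  suffices h : ∃ (n : ℕ) (G : SignedGraph (Fin n)), G.Connected ∧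
      G.degreeSet = Set.range (fun x => ∑ y, sgn D x y) by
    obtain ⟨n, G, hG, hD⟩ := h
    refine ⟨n, G, hG, hD.trans ?_⟩
    ext z
    simp only [Set.mem_range, Finset.mem_coe]
    constructor
    · rintro ⟨i | v, rfl⟩
      · rw [sgn_hub]; exact h0
      · rw [sgn_blk]; exact v.1.1.2
    · intro hz
      by_cases hz0 : z = 0
      · exact ⟨.inl true, by rw [sgn_hub, hz0]⟩
      · exact ⟨.inr ⟨⟨⟨z, hz⟩, ⟨0, by simp only; omega⟩⟩, true⟩, by rw [sgn_blk]⟩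
  refine exists_of_sign (sgn D) ?_ ?_ ?_ (.inl true) ?_
  · rintro (i | v) (j | u) <;> simp only [sgn]
    by_cases h : v.1.1 = u.1.1
    · simp [h, eq_comm]
    · simp [h, Ne.symm h]
  · rintro (i | v) <;> simp [sgn]
  · rintro (i | v) (j | u) <;> simp only [sgn] <;> try split_ifs
    all_goals try simp
    omega
  · rintro (i | v)
    · exact Relation.ReflTransGen.tail (b := .inr (w, true))
        (Relation.ReflTransGen.single (hne true (w, true))) (hne' i (w, true))
    · exact Relation.ReflTransGen.single (hne true v)
end

section
/- Let d1 < d2 be positive integers. The signed graph obtained by taking an all-positive complete graph K_{d1} on d1 vertices together with d2 - d1 + 1 isolated vertices, and joining every vertex of K_{d1} to each of the additional vertices by a positive edge, is a connected signed graph on d2 + 1 vertices in which every vertex of K_{d1} has signed degree d2 and every additional vertex has signed degree d1; hence its signed degree set is {d1, d2}. -/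
/-- Let `d1 < d2` be positive integers. The signed graph on `d2 + 1` vertices
consisting of an all-positive complete graph on the first `d1` vertices, with every
one of its vertices joined by a positive edge to each of the remaining
`d2 - d1 + 1` vertices (which are otherwise isolated), is connected, every vertex
of the complete part has signed degree `d2`, every additional vertex has signed
degree `d1`, and its signed degree set is `{d1, d2}`. -/
theorem stmt_13 (d1 d2 : ℕ) (h1 : 0 < d1) (h12 : d1 < d2)
    (G : SignedGraph (Fin (d2 + 1)))
    (hpos : ∀ a b : Fin (d2 + 1),
      G.pos.Adj a b ↔ a ≠ b ∧ ((a : ℕ) < d1 ∨ (b : ℕ) < d1))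
    (hneg : G.neg = ⊥) :
    G.Connected ∧
      (∀ a : Fin (d2 + 1), (a : ℕ) < d1 → G.sdeg a = (d2 : ℤ)) ∧
      (∀ a : Fin (d2 + 1), d1 ≤ (a : ℕ) → G.sdeg a = (d1 : ℤ)) ∧
      G.degreeSet = {(d1 : ℤ), (d2 : ℤ)} := by
  have hn : ∀ a, Nat.card {u : Fin (d2 + 1) // G.neg.Adj a u} = 0 := by
    intro a
    simp [hneg]
  have hA : ∀ a : Fin (d2 + 1), (a : ℕ) < d1 → G.sdeg a = (d2 : ℤ) := by
    intro a ha
    have h : Nat.card {u : Fin (d2 + 1) // G.pos.Adj a u} = d2 := by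
      have e : ∀ u, G.pos.Adj a u ↔ u ∈ (Finset.univ.erase a : Finset (Fin (d2 + 1))) := by
        intro u
        rw [hpos]
        simp [ha, ne_comm]
      rw [Nat.card_congr (Equiv.subtypeEquivRight e), Nat.card_eq_fintype_card,
        Fintype.card_coe, Finset.card_erase_of_mem (Finset.mem_univ a)]
      simp
    rw [SignedGraph.sdeg, h, hn]
    simp
  have hB : ∀ a : Fin (d2 + 1), d1 ≤ (a : ℕ) → G.sdeg a = (d1 : ℤ) := by
    intro a ha
    have h : Nat.card {u : Fin (d2 + 1) // G.pos.Adj a u} = d1 := by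
      have e : ∀ u, G.pos.Adj a u ↔
          u ∈ (Finset.Iio (⟨d1, by omega⟩ : Fin (d2 + 1))) := by
        intro u
        rw [hpos]
        simp only [Finset.mem_Iio, Fin.lt_def, ne_eq, Fin.ext_iff]
        omega
      rw [Nat.card_congr (Equiv.subtypeEquivRight e), Nat.card_eq_fintype_card,
        Fintype.card_coe, Fin.card_Iio]
    rw [SignedGraph.sdeg, h, hn]
    simp
  refine ⟨?_, hA, hB, ?_⟩
  · have hz : ∀ v, G.underlying.Reachable 0 v := by
      intro v
      by_cases hv : (0 : Fin (d2 + 1)) = v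
      · rw [hv]
      · apply SimpleGraph.Adj.reachable
        left
        exact (hpos _ _).2 ⟨hv, Or.inl (by simpa using h1)⟩
    exact SimpleGraph.Connected.mk (fun u v => (hz u).symm.trans (hz v))
  · ext x
    simp only [SignedGraph.degreeSet, Set.mem_range, Set.mem_insert_iff,
      Set.mem_singleton_iff]
    constructor
    · rintro ⟨a, rfl⟩
      rcases lt_or_ge (a : ℕ) d1 with h | h
      · exact Or.inr (hA a h)
      · exact Or.inl (hB a h)
    · rintro (rfl | rfl)
      · exact ⟨⟨d1, by omega⟩, hB _ le_rfl⟩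
      · exact ⟨0, hA _ (by simpa using h1)⟩
end

section
/- Let d1 < d2 < ... < dk < d(k+1) be positive integers. Suppose there exists a connected signed graph G1 on dk - d1 + 1 vertices with signed degree set {d2 - d1, d3 - d1, ..., dk - d1}. Then the signed graph obtained from the disjoint union of G1, an all-positive complete graph K_{d1} on d1 vertices, and d(k+1) - dk isolated vertices, by joining every vertex of K_{d1} to every vertex of G1 with a positive edge and to every isolated vertex with a positive edge, is a connected signed graph on d(k+1) + 1 vertices with signed degree set {d1, d2, ..., dk, d(k+1)}. -/
theorem card_sum_subtype {A B C : Type} [Finite A] [Finite B] [Finite C]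
    (P : A ⊕ B ⊕ C → Prop) :
    Nat.card {u // P u} = Nat.card {a : A // P (Sum.inl a)} +
      (Nat.card {b : B // P (Sum.inr (Sum.inl b))} +
        Nat.card {c : C // P (Sum.inr (Sum.inr c))}) := by
  rw [Nat.card_congr (Equiv.subtypeSum (p := P)), Nat.card_sum]
  congr 1
  rw [Nat.card_congr (Equiv.subtypeSum (p := fun x : B ⊕ C => P (Sum.inr x))), Nat.card_sum]

theorem card_ne {n : ℕ} (p : Fin n) : Nat.card {q : Fin n // ¬ p = q} = n - 1 := by
  have h := Fintype.card_subtype_compl (fun q : Fin n => p = q)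
  rw [Nat.card_eq_fintype_card, h]
  simp

/-- Induction step: given positive integers `d 1 < d 2 < ⋯ < d k < d (k+1)` and a
connected signed graph `G1` on `d k - d 1 + 1` vertices with signed degree set
`{d 2 - d 1, …, d k - d 1}`, the signed graph obtained from the disjoint union of
`G1`, an all-positive complete graph on `d 1` vertices, and `d (k+1) - d k`
isolated vertices by joining every vertex of the complete part by positive edges
to all vertices of `G1` and to all isolated vertices, is a connected signed graph
on `d (k+1) + 1` vertices with signed degree set `{d 1, d 2, …, d (k+1)}`. -/
theorem stmt_14 (k : ℕ) (hk : 2 ≤ k) (d : ℕ → ℕ) (hd1 : 0 < d 1)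
    (hmono : ∀ i, 1 ≤ i → i ≤ k → d i < d (i + 1))
    (G1 : SignedGraph (Fin (d k - d 1 + 1)))
    (hG1conn : G1.Connected)
    (hG1deg : G1.degreeSet = {x : ℤ | ∃ i, 2 ≤ i ∧ i ≤ k ∧ x = (d i : ℤ) - (d 1 : ℤ)})
    (G : SignedGraph (Fin (d k - d 1 + 1) ⊕ Fin (d 1) ⊕ Fin (d (k + 1) - d k)))
    (hpos : ∀ a b, G.pos.Adj a b ↔
      (∃ p q, a = Sum.inl p ∧ b = Sum.inl q ∧ G1.pos.Adj p q) ∨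
      (∃ p q, a = Sum.inr (Sum.inl p) ∧ b = Sum.inr (Sum.inl q) ∧ p ≠ q) ∨
      (∃ p q, (a = Sum.inr (Sum.inl p) ∧ b = Sum.inl q) ∨
              (a = Sum.inl q ∧ b = Sum.inr (Sum.inl p))) ∨
      (∃ p w, (a = Sum.inr (Sum.inl p) ∧ b = Sum.inr (Sum.inr w)) ∨
              (a = Sum.inr (Sum.inr w) ∧ b = Sum.inr (Sum.inl p))))
    (hneg : ∀ a b, G.neg.Adj a b ↔
      ∃ p q, a = Sum.inl p ∧ b = Sum.inl q ∧ G1.neg.Adj p q) :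
    G.Connected ∧
      Fintype.card (Fin (d k - d 1 + 1) ⊕ Fin (d 1) ⊕ Fin (d (k + 1) - d k)) =
        d (k + 1) + 1 ∧
      G.degreeSet = {x : ℤ | ∃ i, 1 ≤ i ∧ i ≤ k + 1 ∧ x = (d i : ℤ)} := by
  have hle : ∀ i, 2 ≤ i → i ≤ k → d 1 < d i := by
    intro i hi
    induction i, hi using Nat.le_induction with
    | base => intro h; exact hmono 1 le_rfl (by omega)
    | succ n hn ih =>
      intro h
      exact (ih (by omega)).trans (hmono n (by omega) (by omega))
  have h1k := hle k hk le_rfl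
  have hkk := hmono k (by omega) le_rfl
  have s1 : ∀ v, G.sdeg (Sum.inl v) = G1.sdeg v + d 1 := by
    intro v
    unfold SignedGraph.sdeg
    rw [card_sum_subtype, card_sum_subtype]
    simp [hpos, hneg]
    ring
  have s2 : ∀ v, G.sdeg (Sum.inr (Sum.inl v)) = d (k + 1) := by
    intro v
    unfold SignedGraph.sdeg
    rw [card_sum_subtype, card_sum_subtype]
    simp [hpos, hneg, card_ne]
    omega
  have s3 : ∀ v, G.sdeg (Sum.inr (Sum.inr v)) = d 1 := by
    intro v
    unfold SignedGraph.sdeg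
    rw [card_sum_subtype, card_sum_subtype]
    simp [hpos, hneg]
  refine ⟨?_, ?_, ?_⟩
  · unfold SignedGraph.Connected
    rw [SimpleGraph.connected_iff_exists_forall_reachable]
    refine ⟨Sum.inr (Sum.inl ⟨0, hd1⟩), ?_⟩
    intro w
    by_cases hw : Sum.inr (Sum.inl ⟨0, hd1⟩) = w
    · rw [hw]
    · apply SimpleGraph.Adj.reachable
      left
      rw [hpos]
      rcases w with w | w | w
      · simp
      · simpa using hw
      · simp
  · simp
    omega
  · have hmem : ∀ x, x ∈ G1.degreeSet ↔ ∃ i, 2 ≤ i ∧ i ≤ k ∧ x = (d i : ℤ) - (d 1 : ℤ) := by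
      intro x; rw [hG1deg]; rfl
    ext x
    constructor
    · rintro ⟨v | v | v, rfl⟩
      · obtain ⟨i, h2, h3, h4⟩ := (hmem _).1 ⟨v, rfl⟩
        exact ⟨i, by omega, by omega, by rw [s1, h4]; ring⟩
      · exact ⟨k + 1, by omega, le_rfl, s2 v⟩
      · exact ⟨1, le_rfl, by omega, s3 v⟩
    · rintro ⟨i, h2, h3, rfl⟩
      by_cases hi : i = 1
      · subst hi
        exact ⟨Sum.inr (Sum.inr ⟨0, by omega⟩), s3 _⟩
      by_cases hi2 : i = k + 1
      · subst hi2
        exact ⟨Sum.inr (Sum.inl ⟨0, hd1⟩), s2 _⟩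
      obtain ⟨v, hv⟩ := (hmem _).2 ⟨i, by omega, by omega, rfl⟩
      exact ⟨Sum.inl v, by rw [s1, hv]; ring⟩
end

section
/- Let G1 and G2 be disjoint connected signed graphs, let uv be a positive edge of G1, let x be a vertex of G2, and let y be a new vertex. The signed graph G obtained from the disjoint union of G1 and G2 by adding the vertex y, the positive edges uy and vx, and the negative edges ux and vy, is a connected signed graph in which every vertex of G1 and of G2 has the same signed degree as before and the vertex y has signed degree 0; hence the signed degree set of G is the union of the signed degree sets of G1 and G2 together with 0. -/
theorem card_subtype_sum_aux {A B : Type*} [Finite A] [Finite B] (P : A ⊕ B → Prop) :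
    Nat.card {c // P c} = Nat.card {a // P (Sum.inl a)} + Nat.card {b // P (Sum.inr b)} := by
  rw [Nat.card_congr (Equiv.subtypeSum (p := P)), Nat.card_sum]

open Classical in
theorem card_and_eq_aux {A : Type*} (c : Prop) (x : A) :
    Nat.card {b : A // c ∧ b = x} = if c then 1 else 0 := by
  by_cases h : c <;> simp [h]

open Classical in
theorem card_unit_aux (c : Prop) :
    Nat.card {_b : Unit // c} = if c then 1 else 0 := by
  by_cases h : c <;> simp [h]

/-- Given disjoint connected signed graphs `G1` (with a positive edge `uv`) and
`G2`, a vertex `x` of `G2` and a new vertex `y`, adding the positive edges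
`uy, vx` and the negative edges `ux, vy` yields a connected signed graph in which
every old vertex keeps its signed degree and `y` has signed degree `0`; hence its
signed degree set is the union of the two signed degree sets together with `0`. -/
theorem stmt_17 {V1 V2 : Type*} [Fintype V1] [Fintype V2]
    (G1 : SignedGraph V1) (G2 : SignedGraph V2)
    (hG1conn : G1.Connected) (hG2conn : G2.Connected)
    (u v : V1) (huv : G1.pos.Adj u v) (x : V2)
    (G : SignedGraph (V1 ⊕ V2 ⊕ Unit))
    (hpos : ∀ a b, G.pos.Adj a b ↔
      (∃ p q, a = Sum.inl p ∧ b = Sum.inl q ∧ G1.pos.Adj p q) ∨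
      (∃ p q, a = Sum.inr (Sum.inl p) ∧ b = Sum.inr (Sum.inl q) ∧ G2.pos.Adj p q) ∨
      (a = Sum.inl u ∧ b = Sum.inr (Sum.inr ())) ∨
      (a = Sum.inr (Sum.inr ()) ∧ b = Sum.inl u) ∨
      (a = Sum.inl v ∧ b = Sum.inr (Sum.inl x)) ∨
      (a = Sum.inr (Sum.inl x) ∧ b = Sum.inl v))
    (hneg : ∀ a b, G.neg.Adj a b ↔
      (∃ p q, a = Sum.inl p ∧ b = Sum.inl q ∧ G1.neg.Adj p q) ∨
      (∃ p q, a = Sum.inr (Sum.inl p) ∧ b = Sum.inr (Sum.inl q) ∧ G2.neg.Adj p q) ∨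
      (a = Sum.inl u ∧ b = Sum.inr (Sum.inl x)) ∨
      (a = Sum.inr (Sum.inl x) ∧ b = Sum.inl u) ∨
      (a = Sum.inl v ∧ b = Sum.inr (Sum.inr ())) ∨
      (a = Sum.inr (Sum.inr ()) ∧ b = Sum.inl v)) :
    G.Connected ∧
      (∀ p : V1, G.sdeg (Sum.inl p) = G1.sdeg p) ∧
      (∀ q : V2, G.sdeg (Sum.inr (Sum.inl q)) = G2.sdeg q) ∧
      G.sdeg (Sum.inr (Sum.inr ())) = 0 ∧
      G.degreeSet = G1.degreeSet ∪ G2.degreeSet ∪ {0} := by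
  classical
  have h1 : ∀ p : V1, G.sdeg (Sum.inl p) = G1.sdeg p := by
    intro p
    unfold SignedGraph.sdeg
    simp only [card_subtype_sum_aux, hpos, hneg]
    simp [-Nat.card_eq_fintype_card, card_and_eq_aux, card_unit_aux]
    ring
  have h2 : ∀ q : V2, G.sdeg (Sum.inr (Sum.inl q)) = G2.sdeg q := by
    intro q
    unfold SignedGraph.sdeg
    simp only [card_subtype_sum_aux, hpos, hneg]
    simp [-Nat.card_eq_fintype_card, card_and_eq_aux]
  have h3 : G.sdeg (Sum.inr (Sum.inr ())) = 0 := by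
    unfold SignedGraph.sdeg
    simp only [card_subtype_sum_aux, hpos, hneg]
    simp
  refine ⟨?_, h1, h2, h3, ?_⟩
  · let f1 : G1.underlying →g G.underlying :=
      ⟨Sum.inl, by
        intro a b h
        rcases h with h | h
        · exact Or.inl ((hpos _ _).2 (Or.inl ⟨a, b, rfl, rfl, h⟩))
        · exact Or.inr ((hneg _ _).2 (Or.inl ⟨a, b, rfl, rfl, h⟩))⟩
    let f2 : G2.underlying →g G.underlying :=
      ⟨fun b => Sum.inr (Sum.inl b), by
        intro a b h
        rcases h with h | h
        · exact Or.inl ((hpos _ _).2 (Or.inr (Or.inl ⟨a, b, rfl, rfl, h⟩)))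
        · exact Or.inr ((hneg _ _).2 (Or.inr (Or.inl ⟨a, b, rfl, rfl, h⟩)))⟩
    have r1 : ∀ p, G.underlying.Reachable (Sum.inl u) (Sum.inl p) := fun p =>
      (SimpleGraph.Connected.preconnected hG1conn u p).map f1
    have ey : G.underlying.Adj (Sum.inl u) (Sum.inr (Sum.inr ())) :=
      Or.inl ((hpos _ _).2 (by simp))
    have ex : G.underlying.Adj (Sum.inl u) (Sum.inr (Sum.inl x)) :=
      Or.inr ((hneg _ _).2 (by simp))
    have r2 : ∀ q, G.underlying.Reachable (Sum.inl u) (Sum.inr (Sum.inl q)) := fun q =>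
      ex.reachable.trans ((SimpleGraph.Connected.preconnected hG2conn x q).map f2)
    have r : ∀ a, G.underlying.Reachable (Sum.inl u) a := by
      rintro (p | q | ⟨⟩)
      · exact r1 p
      · exact r2 q
      · exact ey.reachable
    exact (SimpleGraph.connected_iff_exists_forall_reachable _).2 ⟨_, r⟩
  · ext d
    simp only [SignedGraph.degreeSet, Set.mem_union, Set.mem_range, Set.mem_singleton_iff,
      Sum.exists, h1, h2]
    constructor
    · rintro (h | h | ⟨⟨⟩, h⟩)
      · exact Or.inl (Or.inl h)
      · exact Or.inl (Or.inr h)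
      · exact Or.inr (h.symm.trans h3)
    · rintro ((h | h) | h)
      · exact Or.inl h
      · exact Or.inr (Or.inl h)
      · exact Or.inr (Or.inr ⟨(), h3.trans h.symm⟩)
end
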